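/- Fix d ≥ 1 and a positive integer l. Then there exists a real number c > 0 with the following property: for every compact polytope □ = conv(F) ⊆ ℝ^d, where F is a finite subset of (1/l) • ℤ^d, such that □ has nonempty interior and ℤ^d ∩ interior □ ≠ ∅, the Pikhurko constant satisfies γ(ℤ^d, □) ≥ c. -/

import Mathlib

open Pointwise

/-- The coefficient of asymmetry `γ(P ∈ K) = sSup {t ≥ 0 : P + t • (K - K) ⊆ K}`. -/
noncomputable def asym {E : Type*} [AddCommGroup E] [Module ℝ E] (K : Set E) (P : E) : ℝ :=
  sSup {t : ℝ | 0 ≤ t ∧ ∀ x ∈ K - K, P + t • x ∈ K}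

/-- The integer lattice `ℤ^d` inside `ℝ^d`. -/
def intLat (d : ℕ) : Set (Fin d → ℝ) := {x | ∀ i, ∃ z : ℤ, x i = (z : ℝ)}

/-- The Pikhurko constant `γ(ℤ^d, K)`: the supremum of the coefficients of asymmetry over
lattice points of the interior of `K`. -/
noncomputable def pik {d : ℕ} (K : Set (Fin d → ℝ)) : ℝ :=
  sSup (asym K '' (intLat d ∩ interior K))

/-- Simultaneous Dirichlet approximation. -/
theorem exists_simultaneous_approx {ι : Type*} [Fintype ι] (α : ι → ℝ) {D : ℕ} (hD : 0 < D) :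
    ∃ k : ℕ, 1 ≤ k ∧ k ≤ D ^ Fintype.card ι ∧ ∃ p : ι → ℤ, ∀ i, |k * α i - p i| ≤ 1 / D := by
  classical
  have hD' : (0 : ℝ) < D := by exact_mod_cast hD
  have hbox (k : ℕ) (i : ι) : ⌊(D : ℝ) * Int.fract (k * α i)⌋₊ < D := by
    rw [Nat.floor_lt (by positivity)]
    nlinarith [Int.fract_lt_one (k * α i)]
  let f : Fin (D ^ Fintype.card ι + 1) → ι → Fin D := fun k i => ⟨_, hbox k i⟩
  obtain ⟨a, b, hab, hf⟩ := Fintype.exists_ne_map_eq_of_card_lt f (by simp)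
  wlog hlt : a < b generalizing a b
  · exact this b a hab.symm hf.symm (lt_of_le_of_ne (not_lt.mp hlt) hab.symm)
  have hlt' : (a : ℕ) < b := hlt
  refine ⟨b - a, by omega, by omega, fun i => ⌊b * α i⌋ - ⌊a * α i⌋, fun i => ?_⟩
  have h1 : ⌊(D : ℝ) * Int.fract ((a : ℕ) * α i)⌋₊ = ⌊(D : ℝ) * Int.fract ((b : ℕ) * α i)⌋₊ :=
    congrArg Fin.val (congrFun hf i)
  have ha := Nat.floor_le (a := (D : ℝ) * Int.fract ((a : ℕ) * α i)) (by positivity)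
  have hb := Nat.floor_le (a := (D : ℝ) * Int.fract ((b : ℕ) * α i)) (by positivity)
  have ha' := Nat.lt_floor_add_one ((D : ℝ) * Int.fract ((a : ℕ) * α i))
  have hb' := Nat.lt_floor_add_one ((D : ℝ) * Int.fract ((b : ℕ) * α i))
  rw [h1] at ha ha'
  have key : ((b - a : ℕ) : ℝ) * α i - ((⌊(b : ℕ) * α i⌋ - ⌊(a : ℕ) * α i⌋ : ℤ) : ℝ)
      = Int.fract ((b : ℕ) * α i) - Int.fract ((a : ℕ) * α i) := by
    rw [Nat.cast_sub hlt'.le, Int.fract, Int.fract]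
    push_cast
    ring
  rw [key, abs_le, ← neg_div, div_le_iff₀ hD', le_div_iff₀ hD']
  constructor <;> linarith

/-- `μ` is obtained from the barycentric coordinates `w` by dilating with a factor `1 + l * q`
and translating by integer multiples of `l`, keeping the sum of coordinates equal to one. -/
def LatticeReach {ι : Type*} [Fintype ι] (l : ℕ) (w μ : ι → ℝ) : Prop :=
  ∃ (q : ℤ) (p : ι → ℤ), ∑ i, p i = q ∧ ∀ i, μ i = (1 + l * q) * w i - l * p i

theorem LatticeReach.refl {ι : Type*} [Fintype ι] (l : ℕ) (w : ι → ℝ) : LatticeReach l w w :=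
  ⟨0, 0, by simp, by simp⟩

theorem LatticeReach.trans {ι : Type*} [Fintype ι] {l : ℕ} {w μ ν : ι → ℝ}
    (h : LatticeReach l w μ) (h' : LatticeReach l μ ν) : LatticeReach l w ν := by
  obtain ⟨q, p, hp, h⟩ := h
  obtain ⟨q', p', hp', h'⟩ := h'
  refine ⟨q + q' + l * q * q', fun i => (1 + l * q') * p i + p' i, ?_, fun i => ?_⟩
  · rw [Finset.sum_add_distrib, ← Finset.mul_sum, hp, hp']
    ring
  · rw [h', h]
    push_cast
    ring

theorem LatticeReach.sum_eq_one {ι : Type*} [Fintype ι] {l : ℕ} {w μ : ι → ℝ}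
    (h : LatticeReach l w μ) (hw : ∑ i, w i = 1) : ∑ i, μ i = 1 := by
  obtain ⟨q, p, hp, h⟩ := h
  simp only [h, Finset.sum_sub_distrib, ← Finset.mul_sum, hw]
  rw [← Int.cast_sum, hp]
  ring

open Classical in
/-- If some coordinate is small, a lattice move decreases the number of small coordinates, at the
cost of lowering the threshold for being small. -/
theorem exists_latticeReach_card_lt {n l : ℕ} (hn : 0 < n) (hl : 0 < l) {c : ℝ} (hc : 0 < c) :
    ∃ c' : ℝ, 0 < c' ∧ c' ≤ c ∧ ∀ (ι : Type) [Fintype ι] (w : ι → ℝ), Fintype.card ι ≤ n →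
      (∀ i, 0 < w i) → ∑ i, w i = 1 → (∃ i, w i < c) →
      ∃ μ, LatticeReach l w μ ∧ (∀ i, 0 < μ i) ∧
        (Finset.univ.filter (fun i => μ i < c')).card <
          (Finset.univ.filter (fun i => w i < c)).card := by
  obtain ⟨D, hD⟩ := exists_nat_ge (max (2 * l / c) (4 * n))
  have hn' : (0 : ℝ) < n := by exact_mod_cast hn
  have hl' : (1 : ℝ) ≤ l := by exact_mod_cast hl
  have hDc : 2 * l / c ≤ (D : ℝ) := (le_max_left _ _).trans hD
  have hDn : 4 * n ≤ (D : ℝ) := (le_max_right _ _).trans hD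
  have hD0 : (0 : ℝ) < D := by linarith
  have hD1 : 0 < D := by exact_mod_cast hD0
  have hlD : l * (1 / D : ℝ) ≤ c / 2 := by
    rw [div_le_iff₀ hc] at hDc
    rw [mul_one_div, div_le_iff₀ hD0]
    linarith
  have hDn' : 1 / (D : ℝ) ≤ 1 / (4 * n) := one_div_le_one_div_of_le (by positivity) hDn
  set N : ℕ := D ^ n with hN
  have hN1 : 1 ≤ N := Nat.one_le_pow _ _ hD1
  have hN0 : (1 : ℝ) ≤ N := by exact_mod_cast hN1
  set M : ℝ := 4 * n * l * N with hM
  have hM0 : 0 < M := by positivity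
  refine ⟨min (c / 2) (1 / (2 * M)), by positivity, (min_le_left _ _).trans (by linarith),
    fun ι _ w hι hw hsum ⟨i₀, hi₀⟩ => ?_⟩
  set c' := min (c / 2) (1 / (2 * M)) with hc'
  have hcc : c' ≤ c / 2 := min_le_left _ _
  have hcM : c' ≤ 1 / (2 * M) := min_le_right _ _
  have hM2 : 1 / (2 * M) = 1 / M / 2 := by field_simp
  obtain ⟨b, hb, hmax⟩ := Finset.exists_max_image (Finset.univ.filter (fun i => w i < c)) w
    ⟨i₀, by simpa using hi₀⟩
  have hb' : w b < c := by simpa using hb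
  replace hmax : ∀ i, w i < c → w i ≤ w b := fun i hi => hmax i (by simpa using hi)
  have hcard : ∀ μ : ι → ℝ, (∀ i, c ≤ w i → c' ≤ μ i) → c' ≤ μ b →
      (Finset.univ.filter (fun i => μ i < c')).card <
          (Finset.univ.filter (fun i => w i < c)).card := by
    intro μ h1 h2
    refine Finset.card_lt_card ⟨fun i hi => ?_, fun h => ?_⟩
    · simp only [Finset.mem_filter, Finset.mem_univ, true_and] at hi ⊢
      exact not_le.mp fun h => absurd (h1 i h) (not_le.mpr hi)
    · have := h hb
      simp only [Finset.mem_filter, Finset.mem_univ, true_and] at this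
      linarith
  have hMpos : 0 < 1 / M := by positivity
  by_cases hbM : 1 / M < w b
  · exact ⟨w, .refl l w, hw, hcard w (fun i hi => by linarith) (by linarith)⟩
  rw [not_lt] at hbM
  have hwb := hw b
  set t : ℕ := ⌊1 / (M * w b)⌋₊ with ht
  have ht1 : (1 : ℝ) ≤ 1 / (M * w b) := by
    rw [le_div_iff₀ hM0] at hbM
    rw [le_div_iff₀ (by positivity)]
    linarith
  have htnat : 1 ≤ t := (Nat.one_le_floor_iff _).mpr ht1
  have htle : (t : ℝ) * w b ≤ 1 / M := by
    have := Nat.floor_le (a := 1 / (M * w b)) (by positivity)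
    rw [← ht, le_div_iff₀ (by positivity)] at this
    rw [le_div_iff₀ hM0]
    linarith
  have htge : 1 / (2 * M) ≤ (t : ℝ) * w b := by
    have h1 := Nat.lt_floor_add_one (1 / (M * w b))
    rw [← ht, div_lt_iff₀ (by positivity)] at h1
    have h2 : (1 : ℝ) ≤ t := by exact_mod_cast htnat
    rw [div_le_iff₀ (by positivity)]
    nlinarith [mul_pos hM0 hwb]
  obtain ⟨k, hk1, hkN, p, hp⟩ := exists_simultaneous_approx (fun i => t * w i) hD1
  replace hkN : (k : ℝ) ≤ N := by
    exact_mod_cast hkN.trans (Nat.pow_le_pow_right hD1 hι)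
  have hk1' : (1 : ℝ) ≤ k := by exact_mod_cast hk1
  have hq : ∀ i, w i < c → k * (t * w i) ≤ 1 / (4 * n) := by
    intro i hi
    have h1 : t * w i ≤ 1 / M := le_trans (by gcongr; exact hmax i hi) htle
    have h0 : 0 ≤ t * w i := by have := hw i; positivity
    calc k * (t * w i) ≤ N * (1 / M) := by gcongr
      _ = 1 / (4 * n * l) := by rw [hM]; field_simp
      _ ≤ 1 / (4 * n) := one_div_le_one_div_of_le (by positivity) (by nlinarith)
  set p' : ι → ℤ := fun i => if w i < c then 0 else p i with hp'
  have herr : ∀ i, |k * (t * w i) - p' i| ≤ 1 / (4 * n) := by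
    intro i
    by_cases hi : w i < c
    · have h0 : 0 ≤ k * (t * w i) := by have := hw i; positivity
      simpa [hp', hi, abs_of_nonneg h0] using hq i hi
    · simpa [hp', hi] using (hp i).trans hDn'
  have hsum' : ∑ i, p' i = (k * t : ℤ) := by
    have h1 : |((k * t - ∑ i, p' i : ℤ) : ℝ)| < 1 := by
      have : ((k * t - ∑ i, p' i : ℤ) : ℝ) = ∑ i, (k * (t * w i) - p' i) := by
        rw [Finset.sum_sub_distrib, ← Finset.mul_sum, ← Finset.mul_sum, hsum]
        push_cast
        ring
      rw [this]
      calc _ ≤ ∑ i, |k * (t * w i) - p' i| := Finset.abs_sum_le_sum_abs _ _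
        _ ≤ ∑ _i : ι, 1 / (4 * n : ℝ) := Finset.sum_le_sum fun i _ => herr i
        _ = Fintype.card ι * (1 / (4 * n)) := by simp
        _ ≤ n * (1 / (4 * n)) := by gcongr
        _ < 1 := by field_simp; norm_num
    have h2 : |(k * t - ∑ i, p' i : ℤ)| < 1 := by exact_mod_cast h1
    have := Int.abs_lt_one_iff.mp h2
    linarith
  have hμbad : ∀ i, w i < c →
      (1 + l * ((k * t : ℤ) : ℝ)) * w i - l * p' i = w i + l * k * (t * w i) := by
    intro i hi
    simp [hp', hi]
    ring
  have hμgood : ∀ i, c ≤ w i → c / 2 ≤ (1 + l * ((k * t : ℤ) : ℝ)) * w i - l * p' i := by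
    intro i hi
    have h1 := (abs_le.mp (hp i)).1
    have h2 : p' i = p i := by simp [hp', hi]
    rw [h2]
    push_cast
    nlinarith
  have hlk : 1 ≤ (l : ℝ) * k := by nlinarith
  refine ⟨fun i => (1 + l * ((k * t : ℤ) : ℝ)) * w i - l * p' i, ⟨_, p', hsum', fun i => rfl⟩,
    fun i => ?_, hcard _ (fun i hi => hcc.trans (hμgood i hi)) ?_⟩
  · by_cases hi : w i < c
    · beta_reduce
      rw [hμbad i hi]
      have := hw i
      positivity
    · have := hμgood i (not_lt.mp hi)
      beta_reduce
      linarith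
  · rw [hμbad b hb']
    have : t * w b ≤ l * k * (t * w b) := le_mul_of_one_le_left (by positivity) hlk
    linarith

open Classical in
/-- Positive barycentric coordinates can be moved so that all of them are bounded below by a
constant depending only on `l` and the number of coordinates. -/
theorem exists_latticeReach_forall_le {n l : ℕ} (hn : 0 < n) (hl : 0 < l) :
    ∃ c : ℝ, 0 < c ∧ ∀ (ι : Type) [Fintype ι] (w : ι → ℝ), Fintype.card ι ≤ n →
      (∀ i, 0 < w i) → ∑ i, w i = 1 → ∃ μ, LatticeReach l w μ ∧ ∀ i, c ≤ μ i := by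
  have main (m : ℕ) : ∃ c : ℝ, 0 < c ∧ ∀ (ι : Type) [Fintype ι] (w : ι → ℝ),
      Fintype.card ι ≤ n → (∀ i, 0 < w i) → ∑ i, w i = 1 →
      ∃ μ, LatticeReach l w μ ∧ (∀ i, 0 < μ i) ∧
        (Finset.univ.filter (fun i => μ i < c)).card ≤ n - m := by
    induction m with
    | zero =>
      exact ⟨1, one_pos, fun ι _ w hι hw _ =>
        ⟨w, .refl l w, hw, (Finset.card_le_univ _).trans hι⟩⟩
    | succ m ih =>
      obtain ⟨c, hc, H⟩ := ih
      obtain ⟨c', hc', hcc, H'⟩ := exists_latticeReach_card_lt hn hl hc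
      refine ⟨c', hc', fun ι _ w hι hw hsum => ?_⟩
      obtain ⟨μ, hμ, hpos, hcard⟩ := H ι w hι hw hsum
      by_cases hex : ∃ i, μ i < c
      · obtain ⟨ν, hν, hpos', hcard'⟩ := H' ι μ hι hpos (hμ.sum_eq_one hsum) hex
        exact ⟨ν, hμ.trans hν, hpos', by omega⟩
      · push Not at hex
        refine ⟨μ, hμ, hpos, ?_⟩
        rw [Finset.filter_false_of_mem fun i _ => not_lt.mpr (hcc.trans (hex i))]
        simp
  obtain ⟨c, hc, H⟩ := main n
  refine ⟨c, hc, fun ι _ w hι hw hsum => ?_⟩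
  obtain ⟨μ, hμ, -, hcard⟩ := H ι w hι hw hsum
  refine ⟨μ, hμ, fun i => ?_⟩
  rw [Nat.sub_self, Nat.le_zero, Finset.card_eq_zero] at hcard
  simpa using Finset.filter_eq_empty_iff.mp hcard (Finset.mem_univ i)

/-- A finite affinely spanning set contains an affine basis of maximal volume; with respect to it
all barycentric coordinates on the convex hull are bounded by one. -/
theorem exists_affineBasis_abs_coord_le_one {V : Type*} [AddCommGroup V] [Module ℝ V]
    [FiniteDimensional ℝ V] {s : Set V} (hs : s.Finite) (hspan : affineSpan ℝ s = ⊤) :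
    ∃ (t : Set V) (_ : Fintype t) (b : AffineBasis t ℝ V), Set.range b ⊆ s ∧
      ∀ x ∈ convexHull ℝ s, ∀ i, |b.coord i x| ≤ 1 := by
  classical
  obtain ⟨t, hts, b, hb⟩ := AffineBasis.exists_affine_subbasis hspan
  have : Fintype t := (hs.subset hts).fintype
  have : Finite s := hs
  have : Nonempty (t → s) := ⟨fun i => ⟨i, hts i.2⟩⟩
  obtain ⟨v, hv⟩ := Finite.exists_max (fun v : t → s => |(b.toMatrix (fun i => (v i : V))).det|)
  have hb1 : b.toMatrix (fun i : t => (i : V)) = 1 := by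
    rw [← hb, AffineBasis.toMatrix_self]
  have hpos : 0 < |(b.toMatrix (fun i => (v i : V))).det| := by
    refine lt_of_lt_of_le ?_ (hv (fun i => ⟨i, hts i.2⟩))
    simp [hb1]
  obtain ⟨hind, htop⟩ := (b.isUnit_toMatrix_iff (fun i => (v i : V))).mp
    ((Matrix.isUnit_iff_isUnit_det _).mpr (isUnit_iff_ne_zero.mpr (abs_pos.mp hpos)))
  let b' : AffineBasis t ℝ V := ⟨fun i => (v i : V), hind, htop⟩
  have hb' : ⇑b' = fun i => (v i : V) := rfl
  refine ⟨t, inferInstance, b', ?_, fun x hx i => ?_⟩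
  · rintro _ ⟨i, rfl⟩
    exact (v i).2
  have hconv : Convex ℝ {x | |b'.coord i x| ≤ 1} := by
    have : {x | |b'.coord i x| ≤ 1} = b'.coord i ⁻¹' Set.Icc (-1) 1 := by
      ext x
      simp [abs_le]
    rw [this]
    exact (convex_Icc _ _).affine_preimage _
  refine convexHull_min (fun y hy => ?_) hconv hx
  have hcr := congrFun (b.det_smul_coords_eq_cramer_coords b' y) i
  have hdet : (b.toMatrix (fun j => (Function.update v i ⟨y, hy⟩ j : V))).det =
      (b.toMatrix b').transpose.cramer (b.coords y) i := by
    rw [Matrix.cramer_apply, ← Matrix.det_transpose]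
    congr 1
    ext j k
    by_cases hk : k = i
    · subst hk
      simp [AffineBasis.toMatrix_apply]
    · simp [AffineBasis.toMatrix_apply, hk, hb']
  have hle := hv (Function.update v i ⟨y, hy⟩)
  beta_reduce at hle
  rw [hdet, ← hcr, Pi.smul_apply, smul_eq_mul, abs_mul, hb', AffineBasis.coords_apply] at hle
  exact le_of_mul_le_mul_left (by linarith) hpos

theorem sum_smul_mem_intLat {d l : ℕ} (hl : 0 < l) {ι : Type*} [Fintype ι] {w μ : ι → ℝ}
    {v : ι → Fin d → ℝ} (hv : ∀ j i, ∃ z : ℤ, v j i = (z : ℝ) / l) (h : LatticeReach l w μ)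
    (hP : ∑ j, w j • v j ∈ intLat d) : ∑ j, μ j • v j ∈ intLat d := by
  obtain ⟨q, p, -, h⟩ := h
  choose z hz using hv
  intro i
  obtain ⟨a, ha⟩ := hP i
  refine ⟨(1 + l * q) * a - ∑ j, p j * z j i, ?_⟩
  push_cast
  rw [← ha]
  simp only [Finset.sum_apply, Pi.smul_apply, smul_eq_mul, Finset.mul_sum,
    ← Finset.sum_sub_distrib]
  refine Finset.sum_congr rfl fun j _ => ?_
  rw [h, hz]
  have : (l : ℝ) ≠ 0 := by exact_mod_cast hl.ne'
  field_simp

theorem le_of_add_smul_mem {d : ℕ} {K : Set (Fin d → ℝ)} (hK : Bornology.IsBounded K)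
    {u w P : Fin d → ℝ} (hu : u ∈ K) (hw : w ∈ K) (huw : u ≠ w) {t : ℝ} (ht : 0 ≤ t)
    (h : ∀ x ∈ K - K, P + t • x ∈ K) : t ≤ Metric.diam K / ‖u - w‖ := by
  rw [le_div_iff₀ (norm_pos_iff.mpr (sub_ne_zero.mpr huw))]
  have h0 := h 0 (by simpa using Set.sub_mem_sub hu hu)
  have := Metric.dist_le_diam_of_mem hK (h _ (Set.sub_mem_sub hu hw)) h0
  simpa [dist_eq_norm, norm_smul, abs_of_nonneg ht] using this

theorem le_pik {d : ℕ} (hd : 1 ≤ d) {K : Set (Fin d → ℝ)} (hK : Bornology.IsBounded K)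
    (hint : (interior K).Nonempty) {P : Fin d → ℝ} (hP : P ∈ intLat d) {c : ℝ} (hc : 0 < c)
    (h : ∀ x ∈ K - K, P + c • x ∈ K) : c ≤ pik K := by
  have : Nonempty (Fin d) := ⟨⟨0, hd⟩⟩
  obtain ⟨u, hu⟩ := hint
  obtain ⟨w, hw, hwu⟩ : ∃ w ∈ K, w ≠ u := by
    by_contra! hcon
    have : interior K ⊆ interior {u} := interior_mono hcon
    rw [interior_singleton] at this
    exact this hu
  have hbd (Q : Fin d → ℝ) (t : ℝ) (ht : t ∈ {t : ℝ | 0 ≤ t ∧ ∀ x ∈ K - K, Q + t • x ∈ K}) :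
      t ≤ Metric.diam K / ‖w - u‖ :=
    le_of_add_smul_mem hK hw (interior_subset hu) hwu ht.1 ht.2
  have hPint : P ∈ interior K := by
    have hnhds : (fun y => u + c⁻¹ • (y - P)) ⁻¹' interior K ∈ nhds P := by
      refine (isOpen_interior.preimage (by fun_prop)).mem_nhds ?_
      simpa using hu
    refine mem_interior_iff_mem_nhds.mpr (Filter.mem_of_superset hnhds fun y hy => ?_)
    have := h _ (Set.sub_mem_sub (interior_subset hy) (interior_subset hu))
    simpa [smul_smul, hc.ne'] using this
  have hasym : c ≤ asym K P := le_csSup ⟨_, hbd P⟩ ⟨hc.le, h⟩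
  refine hasym.trans (le_csSup ⟨Metric.diam K / ‖w - u‖, ?_⟩ ⟨P, ⟨hP, hPint⟩, rfl⟩)
  rintro _ ⟨Q, -, rfl⟩
  exact Real.sSup_le (hbd Q) (by positivity)

/-- A point of the interior of `convexHull ℝ s` is a convex combination with positive weights of
a prescribed finite family together with at most `d + 1` points of `s`. -/
theorem exists_pos_weights_of_mem_interior {d : ℕ} {s : Set (Fin d → ℝ)} {κ : Type} [Fintype κ]
    [Nonempty κ] (b : κ → Fin d → ℝ) {P : Fin d → ℝ} (hP : P ∈ interior (convexHull ℝ s)) :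
    ∃ (ι : Type) (_ : Fintype ι) (z : ι → Fin d → ℝ) (w : κ ⊕ ι → ℝ), Fintype.card ι ≤ d + 1 ∧
      Set.range z ⊆ s ∧ (∀ i, 0 < w i) ∧ ∑ i, w i = 1 ∧ ∑ i, w i • Sum.elim b z i = P := by
  set a : Fin d → ℝ := ∑ i, (Fintype.card κ : ℝ)⁻¹ • b i with ha
  have hκ : (0 : ℝ) < Fintype.card κ := by exact_mod_cast Fintype.card_pos
  obtain ⟨ε, hε, hmem⟩ : ∃ ε : ℝ, 0 < ε ∧ P + ε • (P - a) ∈ convexHull ℝ s := by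
    have hcont : Filter.Tendsto (fun ε : ℝ => P + ε • (P - a)) (nhdsWithin 0 (Set.Ioi 0))
        (nhds P) := by
      have : ContinuousAt (fun ε : ℝ => P + ε • (P - a)) 0 := by fun_prop
      simpa [ContinuousAt] using this.tendsto.mono_left nhdsWithin_le_nhds
    obtain ⟨ε, h1, h2⟩ := ((hcont.eventually (mem_interior_iff_mem_nhds.mp hP)).and
      self_mem_nhdsWithin).exists
    exact ⟨ε, h2, h1⟩
  obtain ⟨ι, _, z, w, hz, hind, hw, hsum, hcomb⟩ := eq_pos_convex_span_of_mem_convexHull hmem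
  refine ⟨ι, inferInstance, z, Sum.elim (fun _ => ε / (1 + ε) * (Fintype.card κ : ℝ)⁻¹)
    (fun i => (1 + ε)⁻¹ * w i), ?_, hz, ?_, ?_, ?_⟩
  · simpa using hind.card_le_finrank_succ.trans (Nat.succ_le_succ (Submodule.finrank_le _))
  · rintro (i | i)
    · simp only [Sum.elim_inl]
      positivity
    · have := hw i
      simp only [Sum.elim_inr]
      positivity
  · simp only [Fintype.sum_sum_type, Sum.elim_inl, Sum.elim_inr, ← Finset.mul_sum, hsum]
    simp only [Finset.sum_const, Finset.card_univ, nsmul_eq_mul]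
    field_simp
    ring
  · simp only [Fintype.sum_sum_type, Sum.elim_inl, Sum.elim_inr, mul_smul, ← Finset.smul_sum,
      hcomb]
    rw [Finset.smul_sum, ← ha]
    ext j
    simp only [Pi.add_apply, Pi.smul_apply, Pi.sub_apply, smul_eq_mul]
    field_simp
    ring

/-- **Pikhurko's theorem.** Fix `d ≥ 1` and a positive integer `l`. There is
`c > 0` such that every compact polytope `□ = conv F ⊆ ℝ^d` with vertices in `(1/l) • ℤ^d`,
nonempty interior, and with a lattice point interior to `□`, satisfies `γ(ℤ^d, □) ≥ c`. -/
theorem stmt_10 (d : ℕ) (hd : 1 ≤ d) (l : ℕ) (hl : 0 < l) :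
    ∃ c : ℝ, 0 < c ∧ ∀ (F : Finset (Fin d → ℝ)) (K : Set (Fin d → ℝ)),
      K = convexHull ℝ (F : Set (Fin d → ℝ)) →
      (∀ x ∈ F, ∀ i, ∃ z : ℤ, x i = (z : ℝ) / l) →
      (interior K).Nonempty →
      (intLat d ∩ interior K).Nonempty →
      c ≤ pik K := by
  obtain ⟨c, hc, H⟩ := exists_latticeReach_forall_le (n := 2 * (d + 1)) (by omega) hl
  refine ⟨c / 2, by positivity, ?_⟩
  rintro F K rfl hF hint ⟨P, hPlat, hPint⟩
  obtain ⟨t, _, b, hb, hcoord⟩ := exists_affineBasis_abs_coord_le_one F.finite_toSet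
    (interior_convexHull_nonempty_iff_affineSpan_eq_top.mp hint)
  have : Nonempty t := b.nonempty
  obtain ⟨ι, _, z, w, hι, hz, hw, hsum, hcomb⟩ := exists_pos_weights_of_mem_interior b hPint
  have hcard : Fintype.card t = d + 1 := by simpa using b.card_eq_finrank_add_one
  obtain ⟨μ, hμ, hcμ⟩ := H (t ⊕ ι) w (by rw [Fintype.card_sum]; omega) hw hsum
  have hmem : ∀ i, Sum.elim b z i ∈ (F : Set (Fin d → ℝ)) := by
    rintro (i | i)
    · exact hb ⟨i, rfl⟩
    · exact hz ⟨i, rfl⟩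
  refine le_pik hd ((isBounded_convexHull).mpr F.finite_toSet.isBounded) hint
    (sum_smul_mem_intLat hl (fun j => hF _ (hmem j)) hμ (hcomb ▸ hPlat)) (by positivity) ?_
  rintro _ ⟨x, hx, y, hy, rfl⟩
  have hμsum := hμ.sum_eq_one hsum
  have hexp : ∑ j, μ j • Sum.elim b z j + (c / 2) • (x - y) =
      ∑ j, (μ j + Sum.elim (fun i => c / 2 * (b.coord i x - b.coord i y)) 0 j) •
        Sum.elim b z j := by
    simp only [add_smul, Finset.sum_add_distrib, Fintype.sum_sum_type, Sum.elim_inl,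
      Sum.elim_inr, Pi.zero_apply, zero_smul, Finset.sum_const_zero, add_zero, mul_smul, sub_smul,
      ← Finset.smul_sum, Finset.sum_sub_distrib, b.linear_combination_coord_eq_self]
  beta_reduce
  rw [hexp]
  refine (convex_convexHull ℝ _).sum_mem ?_ ?_ fun j _ => subset_convexHull ℝ _ (hmem j)
  · rintro (i | i) -
    · have h1 := abs_le.mp (hcoord x hx i)
      have h2 := abs_le.mp (hcoord y hy i)
      have h3 := hcμ (Sum.inl i)
      simp only [Sum.elim_inl]
      nlinarith
    · have := hcμ (Sum.inr i)
      simp only [Sum.elim_inr, Pi.zero_apply]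
      linarith
  · rw [Finset.sum_add_distrib, hμsum]
    simp [Fintype.sum_sum_type, ← Finset.mul_sum, Finset.sum_sub_distrib]
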